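/- Let q be a power of an odd prime and let A = 𝔽_q[T]. Let α = [[a, b], [c, d]] ∈ SL₂(A), and assume there exist coprime positive integers r and s and nonzero elements ε₁, ε₂ ∈ 𝔽_q such that b divides a^r − ε₁ and c divides a^s − ε₂ in A. Then α = χ₉ · γ · χ₄ · β · χ₃ · χ₉♡ · γ♡ · χ₄♡ · β♡ · χ₃♡ for some χ₃ ∈ F₃(A³), χ₄ ∈ G₄(A⁴), χ₉ ∈ G₉(A⁹), χ₃♡ ∈ G₃(A³), χ₄♡ ∈ F₄(A⁴), χ₉♡ ∈ F₉(A⁹), γ♡, β ∈ M_Λ, and γ, β♡ ∈ M_Λᵀ. -/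

import Mathlib

open Polynomial Matrix

/-- The elementary matrix `m_{12} = [[1, m], [0, 1]]`. -/
def m₁₂ {R : Type*} [CommRing R] (m : R) : Matrix (Fin 2) (Fin 2) R := !![1, m; 0, 1]

/-- The elementary matrix `m_{21} = [[1, 0], [m, 1]]`. -/
def m₂₁ {R : Type*} [CommRing R] (m : R) : Matrix (Fin 2) (Fin 2) R := !![1, 0; m, 1]

/-- The matrix `J = [[0, 1], [−1, 0]]`. -/
def Jmat (R : Type*) [CommRing R] : Matrix (Fin 2) (Fin 2) R := !![0, 1; -1, 0]

/-- `F_r(m₁, …, m_r)`: the alternating product whose `k`-th factor (k = 1, …, r) is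
`(m_k)_{12}` for odd `k` and `(m_k)_{21}` for even `k`. -/
def Fmat {R : Type*} [CommRing R] (r : ℕ) (m : Fin r → R) : Matrix (Fin 2) (Fin 2) R :=
  ((List.finRange r).map (fun k => if k.val % 2 = 0 then m₁₂ (m k) else m₂₁ (m k))).prod

/-- `G_r(m₁, …, m_r) = J · F_r(m₁, …, m_r) · J⁻¹`. -/
noncomputable def Gmat {R : Type*} [CommRing R] (r : ℕ) (m : Fin r → R) :
    Matrix (Fin 2) (Fin 2) R :=
  Jmat R * Fmat r m * (Jmat R)⁻¹

/-- `F_r(A^r)`: the set of values of `F_r` as `m₁, …, m_r` range over `R`. -/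
def FSet (R : Type*) [CommRing R] (r : ℕ) : Set (Matrix (Fin 2) (Fin 2) R) :=
  Set.range (fun m : Fin r → R => Fmat r m)

/-- `G_r(A^r)`: the set of values of `G_r` as `m₁, …, m_r` range over `R`. -/
def GSet (R : Type*) [CommRing R] (r : ℕ) : Set (Matrix (Fin 2) (Fin 2) R) :=
  Set.range (fun m : Fin r → R => Gmat r m)


/-- The set `M_Λ` of products `[[1+ae, be²], [c, 1+de]] · [[1+ae, ce²], [b, 1+de]]`
with `a, b, c, d, e ∈ R` such that the first factor has determinant `1`. -/
def MLambda (R : Type*) [CommRing R] : Set (Matrix (Fin 2) (Fin 2) R) :=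
  {x | ∃ a b c d e : R,
    (!![1 + a * e, b * e ^ 2; c, 1 + d * e] : Matrix (Fin 2) (Fin 2) R).det = 1 ∧
    x = !![1 + a * e, b * e ^ 2; c, 1 + d * e] * !![1 + a * e, c * e ^ 2; b, 1 + d * e]}

/-- `M_Λᵀ`: the set of transposes of elements of `M_Λ`. -/
def MLambdaT (R : Type*) [CommRing R] : Set (Matrix (Fin 2) (Fin 2) R) :=
  {x | ∃ y ∈ MLambda R, x = yᵀ}

/-- If `x`, `y` and `p` have no common prime factor, then `x` is coprime to some element of
`y + (p)`. -/
theorem exists_isCoprime_add_mul {R : Type*} [CommRing R] [IsDomain R] [IsPrincipalIdealRing R]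
    (x y p : R) (hx : x ≠ 0) (h : ∀ π, Prime π → π ∣ x → π ∣ y → ¬ π ∣ p) :
    ∃ t, IsCoprime x (y + p * t) := by
  induction x using UniqueFactorizationMonoid.induction_on_prime with
  | h₁ => exact absurd rfl hx
  | h₂ x hu => exact ⟨0, (isCoprime_one_left (x := y + p * 0)).of_isCoprime_of_dvd_left hu.dvd⟩
  | h₃ x π hx0 hπ ih =>
    obtain ⟨t, ht⟩ := ih hx0 fun ρ hρ hρx => h ρ hρ (hρx.mul_left π)
    by_cases hd : π ∣ y + p * t
    · have hp : ¬ π ∣ p := fun hp =>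
        h π hπ (dvd_mul_right _ _) ((dvd_add_left (hp.mul_right t)).1 hd) hp
      have hxπ : ¬ π ∣ x := fun hxπ => hπ.not_isUnit (ht.isUnit_of_dvd' hxπ hd)
      refine ⟨t + x, IsCoprime.mul_left ?_ ?_⟩
      · rw [hπ.irreducible.coprime_iff_not_dvd]
        intro hd'
        have : π ∣ p * x := by
          have := dvd_sub hd' hd
          rwa [show y + p * (t + x) - (y + p * t) = p * x by ring] at this
        exact (hπ.dvd_or_dvd this).elim hp hxπ
      · rw [show y + p * (t + x) = y + p * t + x * p by ring]
        exact ht.add_mul_left_right p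
    · exact ⟨t, (hπ.irreducible.coprime_iff_not_dvd.2 hd).mul_left ht⟩

/-- Over a polynomial ring over a finite field of odd order, a form `u x² + y²` with `u` nonzero
modulo a prime `π` represents every residue class modulo `π`. -/
theorem exists_prime_dvd_quadratic {F : Type*} [Field F] [Fintype F]
    (hq : Odd (Fintype.card F)) {π : F[X]} (hπ : Prime π) (u b : F[X]) (hu : ¬ π ∣ u) :
    ∃ x y, π ∣ u * x ^ 2 + y ^ 2 - b := by
  classical
  have : Fact (Irreducible π) := ⟨hπ.irreducible⟩
  let K := AdjoinRoot π
  have hfin : Module.Finite F K := (AdjoinRoot.powerBasis hπ.ne_zero).finite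
  have : Finite K := Module.finite_of_finite F
  let : Fintype K := Fintype.ofFinite K
  have h2F : (2 : F) ≠ 0 := Ring.two_ne_zero fun h => by
    have := FiniteField.even_card_of_char_two h
    obtain ⟨k, hk⟩ := hq
    omega
  have h2K : ringChar K ≠ 2 := by
    intro h
    have h2 : (2 : K) = 0 := by
      have := ringChar.Nat.cast_ringChar (R := K)
      rw [h] at this
      exact_mod_cast this
    apply h2F
    apply (algebraMap F K).injective
    rw [map_ofNat, map_zero, h2]
  have hcard := FiniteField.odd_card_of_char_ne_two h2K
  have hu' : AdjoinRoot.mk π u ≠ 0 := by rwa [Ne, AdjoinRoot.mk_eq_zero]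
  obtain ⟨x, y, hxy⟩ := FiniteField.exists_root_sum_quadratic
    (f := C (AdjoinRoot.mk π u) * X ^ 2 + C 0 * X + C (- AdjoinRoot.mk π b))
    (g := C (1 : K) * X ^ 2 + C 0 * X + C 0)
    (degree_quadratic hu') (degree_quadratic one_ne_zero) hcard
  obtain ⟨x, rfl⟩ := AdjoinRoot.mk_surjective x
  obtain ⟨y, rfl⟩ := AdjoinRoot.mk_surjective y
  refine ⟨x, y, ?_⟩
  rw [← AdjoinRoot.mk_eq_zero]
  simp at hxy
  simp only [map_sub, map_add, map_mul, map_pow]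
  linear_combination hxy

/-- A form `u x² + y²` with `u` a unit modulo `p` represents every unit modulo `p`. -/
theorem exists_dvd_quadratic {F : Type*} [Field F] [Fintype F]
    (hq : Odd (Fintype.card F)) (p u b : F[X]) (hp : p ≠ 0) (hu : IsCoprime u p)
    (hb : IsCoprime b p) : ∃ x y, p ∣ u * x ^ 2 + y ^ 2 - b := by
  induction p using UniqueFactorizationMonoid.induction_on_prime with
  | h₁ => exact absurd rfl hp
  | h₂ p hunit => exact ⟨0, 0, hunit.dvd⟩
  | h₃ p π hp0 hπ ih =>
    rw [IsCoprime.mul_right_iff] at hu hb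
    have huπ : ¬ π ∣ u := fun h => hπ.not_isUnit (hu.1.isUnit_of_dvd' h dvd_rfl)
    have hbπ : ¬ π ∣ b := fun h => hπ.not_isUnit (hb.1.isUnit_of_dvd' h dvd_rfl)
    have h2F : (2 : F) ≠ 0 := Ring.two_ne_zero fun h => by
      have := FiniteField.even_card_of_char_two h
      obtain ⟨k, hk⟩ := hq
      omega
    have h2 : IsUnit (2 : F[X]) := by
      have := (isUnit_iff_ne_zero.2 h2F).map (C : F →+* F[X])
      rwa [map_ofNat] at this
    obtain ⟨x, y, r, hr⟩ := ih hp0 hu.2 hb.2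
    by_cases hd : π ∣ p
    · obtain ⟨m, hm⟩ := hd
      -- it suffices to solve the linearised congruence
      suffices ∃ s t, π ∣ r + 2 * (u * x * s + y * t) by
        obtain ⟨s, t, w, hw⟩ := this
        refine ⟨x + p * s, y + p * t, w + m * (u * s ^ 2 + t ^ 2), ?_⟩
        linear_combination hr + p * hw + p * (u * s ^ 2 + t ^ 2) * hm
      have key : ∀ z : F[X], ¬ π ∣ z → ∃ s, π ∣ r + z * s := by
        intro z hz
        obtain ⟨i, j, hij⟩ := (hπ.irreducible.coprime_iff_not_dvd (n := z)).2 hz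
        exact ⟨-(r * j), r * i, by linear_combination r * (-hij)⟩
      have hn2 : ∀ z : F[X], ¬ π ∣ z → ¬ π ∣ 2 * z := fun z hz h => by
        rcases hπ.dvd_or_dvd h with h | h
        · exact hπ.not_isUnit (isUnit_of_dvd_unit h h2)
        · exact hz h
      by_cases hx : π ∣ x
      · have hy : ¬ π ∣ y := fun hy => hbπ <| by
          have : b = u * x * x + y * y - π * (m * r) := by
            linear_combination - r * hm - hr
          rw [this]
          exact dvd_sub (dvd_add (hx.mul_left _) (hy.mul_left _)) (dvd_mul_right _ _)
        obtain ⟨t, ht⟩ := key _ (hn2 _ hy)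
        exact ⟨0, t, by convert ht using 1; ring⟩
      · obtain ⟨s, hs⟩ := key _ (hn2 _ fun h => (hπ.dvd_or_dvd h).elim huπ hx)
        exact ⟨s, 0, by convert hs using 1; ring⟩
    · obtain ⟨x', y', h'⟩ := exists_prime_dvd_quadratic hq hπ u b huπ
      have hcop : IsCoprime π p := hπ.irreducible.coprime_iff_not_dvd.2 hd
      obtain ⟨i, j, hij⟩ := hcop
      refine ⟨x * (i * π) + x' * (j * p), y * (i * π) + y' * (j * p),
        IsCoprime.mul_dvd ⟨i, j, hij⟩ ?_ ?_⟩
      · obtain ⟨w, hw⟩ := h'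
        have e1 : x * (i * π) + x' * (j * p) = x' + π * (i * (x - x')) := by
          linear_combination x' * hij
        have e2 : y * (i * π) + y' * (j * p) = y' + π * (i * (y - y')) := by
          linear_combination y' * hij
        rw [e1, e2]
        refine ⟨w + u * (2 * x' * (i * (x - x')) + π * (i * (x - x')) ^ 2) +
          (2 * y' * (i * (y - y')) + π * (i * (y - y')) ^ 2), ?_⟩
        linear_combination hw
      · have e1 : x * (i * π) + x' * (j * p) = x + p * (j * (x' - x)) := by
          linear_combination x * hij
        have e2 : y * (i * π) + y' * (j * p) = y + p * (j * (y' - y)) := by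
          linear_combination y * hij
        rw [e1, e2]
        refine ⟨r + u * (2 * x * (j * (x' - x)) + p * (j * (x' - x)) ^ 2) +
          (2 * y * (j * (y' - y)) + p * (j * (y' - y)) ^ 2), ?_⟩
        linear_combination hr

/-- If `u` and `b` are units modulo `p`, then some element of `b + (p)` is such that
`-u` is a square modulo it. -/
theorem exists_sq_eq_neg_add_mul {F : Type*} [Field F] [Fintype F]
    (hq : Odd (Fintype.card F)) (p u b : F[X]) (hp : p ≠ 0) (hu : IsCoprime u p)
    (hb : IsCoprime b p) : ∃ k l y, u + l * (b + k * p) = -y ^ 2 := by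
  obtain ⟨x, y, hx, w, hw⟩ : ∃ x y, x ≠ 0 ∧ p ∣ u * x ^ 2 + y ^ 2 - b := by
    obtain ⟨x, y, h⟩ := exists_dvd_quadratic hq p u b hp hu hb
    by_cases hx : x = 0
    · refine ⟨p, y, hp, ?_⟩
      obtain ⟨w, hw⟩ := h
      exact ⟨w + u * p, by subst hx; linear_combination hw⟩
    · exact ⟨x, y, hx, h⟩
  obtain ⟨t, i, j, hij⟩ := exists_isCoprime_add_mul x y p hx fun π hπ hπx hπy hπp => by
    refine hπ.not_isUnit (hb.isUnit_of_dvd' ?_ hπp)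
    have : b = u * x * x + y * y - p * w := by linear_combination -hw
    rw [this]
    exact dvd_sub (dvd_add (hπx.mul_left _) (hπy.mul_left _)) (hπp.mul_right _)
  set z := y + p * t with hz
  -- modulo `u * x ^ 2 + z ^ 2`, the element `x` is invertible
  obtain ⟨v, n, hvn⟩ : IsCoprime x (u * x ^ 2 + z ^ 2) := by
    have : IsCoprime x (z ^ 2) := IsCoprime.pow_right ⟨i, j, hij⟩
    have h := this.add_mul_left_right (u * x)
    rwa [show z ^ 2 + x * (u * x) = u * x ^ 2 + z ^ 2 by ring] at h
  refine ⟨w + 2 * y * t + p * t ^ 2, -(v ^ 2 - n * (n * (u * x ^ 2 + z ^ 2) - 2) * u), z * v, ?_⟩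
  have hQ : b + (w + 2 * y * t + p * t ^ 2) * p = u * x ^ 2 + z ^ 2 := by
    rw [hz]
    linear_combination -hw
  rw [hQ]
  linear_combination -u * (v * x + 1 - n * (u * x ^ 2 + z ^ 2)) * hvn

section Conjugation

variable {R : Type*} [CommRing R]

theorem Jmat_inv : (Jmat R)⁻¹ = !![0, -1; 1, 0] := by
  apply Matrix.inv_eq_right_inv
  ext i j : 1
  fin_cases i <;> fin_cases j <;> simp [Jmat]

/-- Conjugation by `J`. -/
noncomputable def conjJ (R : Type*) [CommRing R] :
    Matrix (Fin 2) (Fin 2) R →* Matrix (Fin 2) (Fin 2) R where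
  toFun x := Jmat R * x * (Jmat R)⁻¹
  map_one' := by
    rw [Jmat_inv]
    ext i j : 1
    fin_cases i <;> fin_cases j <;> simp [Jmat]
  map_mul' x y := by
    have h : (Jmat R)⁻¹ * Jmat R = 1 := by
      rw [Jmat_inv]
      ext i j : 1
      fin_cases i <;> fin_cases j <;> simp [Jmat]
    simp only [Matrix.mul_assoc]
    rw [← Matrix.mul_assoc (Jmat R)⁻¹ (Jmat R), h, Matrix.one_mul]

theorem conjJ_of (a b c d : R) : conjJ R !![a, b; c, d] = !![d, -c; -b, a] := by
  change Jmat R * _ * (Jmat R)⁻¹ = _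
  rw [Jmat_inv]
  ext i j : 1
  fin_cases i <;> fin_cases j <;> simp [Jmat]

theorem conjJ_conjJ (x : Matrix (Fin 2) (Fin 2) R) : conjJ R (conjJ R x) = x := by
  rw [x.eta_fin_two, conjJ_of, conjJ_of]
  simp

theorem conjJ_transpose (x : Matrix (Fin 2) (Fin 2) R) : conjJ R xᵀ = (conjJ R x)ᵀ := by
  rw [xᵀ.eta_fin_two, conjJ_of]
  conv_rhs => rw [x.eta_fin_two, conjJ_of]
  ext i j : 1
  fin_cases i <;> fin_cases j <;> simp

theorem conjJ_m₁₂ (x : R) : conjJ R (m₁₂ x) = m₂₁ (-x) := by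
  simp [m₁₂, m₂₁, conjJ_of]

theorem conjJ_m₂₁ (x : R) : conjJ R (m₂₁ x) = m₁₂ (-x) := by
  simp [m₁₂, m₂₁, conjJ_of]

theorem conjJ_mem_GSet {r : ℕ} {x : Matrix (Fin 2) (Fin 2) R} (hx : x ∈ FSet R r) :
    conjJ R x ∈ GSet R r := by
  obtain ⟨m, rfl⟩ := hx
  exact ⟨m, rfl⟩

theorem conjJ_mem_FSet {r : ℕ} {x : Matrix (Fin 2) (Fin 2) R} (hx : x ∈ GSet R r) :
    conjJ R x ∈ FSet R r := by
  obtain ⟨m, rfl⟩ := hx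
  exact ⟨m, (conjJ_conjJ _).symm⟩

theorem conjJ_mem_MLambdaT {x : Matrix (Fin 2) (Fin 2) R} (hx : x ∈ MLambda R) :
    conjJ R x ∈ MLambdaT R := by
  obtain ⟨a, b, c, d, e, hdet, rfl⟩ := hx
  refine ⟨_, ⟨d, -c, -b, a, e, ?_, rfl⟩, ?_⟩
  · rw [Matrix.det_fin_two_of] at hdet ⊢
    linear_combination hdet
  · rw [map_mul, conjJ_of, conjJ_of, Matrix.transpose_mul]
    congr 1 <;> ext i j <;> fin_cases i <;> fin_cases j <;> simp

theorem conjJ_mem_MLambda {x : Matrix (Fin 2) (Fin 2) R} (hx : x ∈ MLambdaT R) :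
    conjJ R x ∈ MLambda R := by
  obtain ⟨y, hy, rfl⟩ := hx
  obtain ⟨z, hz, h⟩ := conjJ_mem_MLambdaT hy
  rw [conjJ_transpose, h, Matrix.transpose_transpose]
  exact hz

theorem one_mem_MLambda : (1 : Matrix (Fin 2) (Fin 2) R) ∈ MLambda R :=
  ⟨0, 0, 0, 0, 0, by simp, by simp [← Matrix.one_fin_two]⟩

theorem one_mem_MLambdaT : (1 : Matrix (Fin 2) (Fin 2) R) ∈ MLambdaT R :=
  ⟨1, one_mem_MLambda, by simp⟩

end Conjugation

section Products

variable {R : Type*} [CommRing R]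

theorem m₁₂_zero : m₁₂ (0 : R) = 1 := by simp [m₁₂, Matrix.one_fin_two]

theorem m₂₁_zero : m₂₁ (0 : R) = 1 := by simp [m₂₁, Matrix.one_fin_two]

theorem m₁₂_mul_m₁₂ (x y : R) : m₁₂ x * m₁₂ y = m₁₂ (x + y) := by
  simp [m₁₂, add_comm]

theorem m₂₁_mul_m₂₁ (x y : R) : m₂₁ x * m₂₁ y = m₂₁ (x + y) := by
  simp [m₂₁]

theorem mul_mem_FSet_three (x y z : R) : m₁₂ x * m₂₁ y * m₁₂ z ∈ FSet R 3 :=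
  ⟨![x, y, z], by simp [Fmat, List.finRange_succ, mul_assoc]⟩

theorem mul_mem_GSet_four (x y z t : R) : m₂₁ x * m₁₂ y * m₂₁ z * m₁₂ t ∈ GSet R 4 := by
  have h : m₁₂ (-x) * m₂₁ (-y) * m₁₂ (-z) * m₂₁ (-t) ∈ FSet R 4 :=
    ⟨![-x, -y, -z, -t], by simp [Fmat, List.finRange_succ, mul_assoc]⟩
  simpa [conjJ_m₁₂, conjJ_m₂₁] using conjJ_mem_GSet h

theorem mul_mem_GSet_nine (x y z t u v w : R) :
    m₂₁ x * m₁₂ y * m₂₁ z * m₁₂ t * m₂₁ u * m₁₂ v * m₂₁ w ∈ GSet R 9 := by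
  have h : m₁₂ (-x) * m₂₁ (-y) * m₁₂ (-z) * m₂₁ (-t) * m₁₂ (-u) * m₂₁ (-v) * m₁₂ (-w) ∈
      FSet R 9 :=
    ⟨![-x, -y, -z, -t, -u, -v, -w, 0, 0], by
      simp [Fmat, List.finRange_succ, mul_assoc, m₁₂_zero, m₂₁_zero]⟩
  simpa [conjJ_m₁₂, conjJ_m₂₁] using conjJ_mem_GSet h

/-- A matrix of determinant one with first row `(p, b)`, where `p` is congruent to a unit
modulo `b`, is a product of five elementary matrices. -/
theorem eq_mul_of_dvd_sub {p b r s E E' : R} (hdet : p * s - b * r = 1) (hE : E * E' = 1)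
    (hb : b ∣ p - E) : ∃ x y z t u : R,
      !![p, b; r, s] = m₂₁ x * m₁₂ y * m₂₁ z * m₁₂ t * m₂₁ u := by
  obtain ⟨k, hk⟩ := hb
  obtain rfl : p = E + b * k := by linear_combination hk
  refine ⟨(r - k * s) * E' - 1 + E', 1, E - 1, -E' + b * E', k, ?_⟩
  ext i j : 1
  fin_cases i <;> fin_cases j <;> simp [m₁₂, m₂₁] <;> grind

end Products

/-- A matrix of determinant one with first row `(p, e b)`, where `p` is congruent to `1`
modulo `e`, equals a matrix with second row `(-b, p)` up to elementary matrices and an element of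
`M_Λ`. -/
theorem exists_shift_MLambda {F : Type*} [Field F] [Fintype F] (hq : Odd (Fintype.card F))
    {p e b u r s : F[X]} (hp : p ≠ 0) (hdet : p * s - e * b * r = 1) (hu : p = 1 + e * u) :
    ∃ x y k₁ k₂ k₃ k₄ k₅ : F[X], ∃ β ∈ MLambda F[X], x * p + y * b = 1 ∧
      !![p, e * b; r, s] =
        !![x, y; -b, p] * m₂₁ k₁ * m₁₂ k₂ * β * m₁₂ k₃ * m₂₁ k₄ * m₁₂ k₅ := by
  obtain ⟨k, l, y, hy⟩ := exists_sq_eq_neg_add_mul hq p u b hp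
    ⟨-e, 1, by linear_combination hu⟩ ⟨-(e * r), s, by linear_combination hdet⟩
  obtain ⟨A, hA⟩ : ∃ A, A = b + k * p := ⟨_, rfl⟩
  rw [← hA] at hy
  -- the second row and the remaining parameter of the right factor in `M_Λ`
  obtain ⟨s', hs'⟩ : ∃ s', s' = s + r * e * k := ⟨_, rfl⟩
  obtain ⟨b', hb'⟩ : ∃ b', b' = r + l * s' := ⟨_, rfl⟩
  obtain ⟨d, hd⟩ : ∃ d, d = y * s' := ⟨_, rfl⟩
  have hw : 1 + d * (e * y) = s' - e * A * b' := by
    linear_combination e * s' * hy + s' * hu - hdet - p * hs' + e * r * hA + e * y * hd +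
      e * A * hb'
  have hdet' : (1 - e * y ^ 2) * (1 + d * (e * y)) - b' * (e * y) ^ 2 * A = 1 := by
    linear_combination (-(e * y ^ 2)) * hw + e * y * hd
  refine ⟨1 + d * (e * y) + ((1 + d * (e * y)) * (l * e) - b' * (e * y) ^ 2) * k,
    (1 + d * (e * y)) * (l * e) - b' * (e * y) ^ 2, -k, -(l * e), e * A, -l, -(e * k), _,
    ⟨-y, b', A, d, e * y, ?_, rfl⟩, ?_, ?_⟩
  · rw [Matrix.det_fin_two_of]
    linear_combination hdet'
  · linear_combination hdet' + (1 + d * (e * y)) * hu + (1 + d * (e * y)) * e * hy -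
      ((1 + d * (e * y)) * (l * e) - b' * (e * y) ^ 2) * hA
  · have h₁ : (!![p, e * b; r, s] : Matrix (Fin 2) (Fin 2) F[X]) =
        !![1 + -y * (e * y), A * (e * y) ^ 2; b', 1 + d * (e * y)] *
          m₁₂ (e * A) * m₂₁ (-l) * m₁₂ (-(e * k)) := by
      ext i j : 1
      fin_cases i <;> fin_cases j <;> simp [m₁₂, m₂₁]
      · linear_combination hu + e * hy
      · linear_combination -e * hA - e * k * (hu + e * hy)
      · linear_combination -hb' + l * hw
      · linear_combination -hs' - hw - e * k * (-hb' + l * hw)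
    have h₂ : !![1 + d * (e * y) + ((1 + d * (e * y)) * (l * e) - b' * (e * y) ^ 2) * k,
        (1 + d * (e * y)) * (l * e) - b' * (e * y) ^ 2; -b, p] * m₂₁ (-k) * m₁₂ (-(l * e)) *
        !![1 + -y * (e * y), b' * (e * y) ^ 2; A, 1 + d * (e * y)] = 1 := by
      ext i j : 1
      fin_cases i <;> fin_cases j <;> simp [m₁₂, m₂₁]
      · linear_combination hdet'
      · ring
      · linear_combination (1 - e * y ^ 2) * hA + A * (hu + e * hy) - l * e * A * hA
      · linear_combination hdet' + b' * (e * y) ^ 2 * hA + (1 + d * (e * y)) * (hu + e * hy) -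
          l * e * (1 + d * (e * y)) * hA
    rw [h₁]
    simp only [← Matrix.mul_assoc]
    rw [h₂, Matrix.one_mul]

/-- The dual of `exists_shift_MLambda` under conjugation by `J`. -/
theorem exists_shift_MLambdaT {F : Type*} [Field F] [Fintype F] (hq : Odd (Fintype.card F))
    {p e b u r s : F[X]} (hp : p ≠ 0) (hdet : p * s - e * b * r = 1) (hu : p = 1 + e * u) :
    ∃ x y k₁ k₂ k₃ k₄ k₅ : F[X], ∃ γ ∈ MLambdaT F[X], p * x + b * y = 1 ∧
      !![s, r; e * b, p] =
        !![p, -b; y, x] * m₁₂ k₁ * m₂₁ k₂ * γ * m₂₁ k₃ * m₁₂ k₄ * m₂₁ k₅ := by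
  obtain ⟨x, y, k₁, k₂, k₃, k₄, k₅, β, hβ, hxy, h⟩ :=
    exists_shift_MLambda (b := -b) (r := -r) (s := s) hq hp (by linear_combination hdet) hu
  refine ⟨x, -y, -k₁, -k₂, -k₃, -k₄, -k₅, conjJ _ β, conjJ_mem_MLambdaT hβ,
    by linear_combination hxy, ?_⟩
  have hconj := congrArg (conjJ F[X]) h
  simp only [map_mul, conjJ_of, conjJ_m₁₂, conjJ_m₂₁] at hconj
  simpa using hconj

/-- The powers of a two by two matrix are combinations of the matrix and the identity. -/
theorem pow_eq_of_fin_two {R : Type*} [CommRing R] (a b c d : R) (n : ℕ) :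
    ∃ P g : R, !![a, b; c, d] ^ n = !![P, g * b; g * c, P + g * (d - a)] ∧ b ∣ P - a ^ n := by
  induction n with
  | zero => exact ⟨1, 0, by simp [Matrix.one_fin_two], by simp⟩
  | succ n ih =>
    obtain ⟨P, g, h, k, hk⟩ := ih
    refine ⟨P * a + g * b * c, P + g * d, ?_, k * a + g * c, by linear_combination a * hk⟩
    rw [pow_succ, h]
    ext i j : 1
    fin_cases i <;> fin_cases j <;> simp <;> ring

/-- If `b` divides `a ^ n - ε`, then the `n`-th power of `[[a, b], [c, d]]` is a product of
sixteen elementary matrices, an element of `M_Λ` and an element of `M_Λᵀ`. -/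
theorem pow_eq_mul_of_dvd {F : Type*} [Field F] [Fintype F] (hq : Odd (Fintype.card F))
    {a b c d : F[X]} (hdet : (!![a, b; c, d] : Matrix (Fin 2) (Fin 2) F[X]).det = 1)
    (n : ℕ) {ε : F} (hε : ε ≠ 0) (hb : b ∣ a ^ n - C ε) :
    ∃ χ₃ ∈ FSet F[X] 3, ∃ χ₄ ∈ GSet F[X] 4, ∃ χ₉ ∈ GSet F[X] 9, ∃ β ∈ MLambda F[X],
      ∃ γ ∈ MLambdaT F[X], !![a, b; c, d] ^ n = χ₉ * γ * χ₄ * β * χ₃ := by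
  obtain ⟨P, g, hpow, hbP⟩ := pow_eq_of_fin_two a b c d n
  have hdetP : P * (P + g * (d - a)) - g * b * (g * c) = 1 := by
    rw [← Matrix.det_fin_two_of, ← hpow, Matrix.det_pow, hdet, one_pow]
  rw [hpow]
  by_cases hP : P = 0
  · have hunit : IsUnit (g * b) := .of_mul_eq_one (-(g * c)) (by
      linear_combination hdetP - (P + g * (d - a)) * hP)
    obtain ⟨x, y, z, t, u, h⟩ :=
      eq_mul_of_dvd_sub (E := 1) (E' := 1) hdetP (one_mul 1) hunit.dvd
    refine ⟨_, mul_mem_FSet_three 0 0 0, _, mul_mem_GSet_four 0 0 0 0, _,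
      mul_mem_GSet_nine x y z t u 0 0, 1, one_mem_MLambda, 1, one_mem_MLambdaT, ?_⟩
    simp [h, m₁₂_zero, m₂₁_zero]
  obtain ⟨g₁, g₂, ⟨u, hu⟩, ⟨v, hv⟩, rfl⟩ : ∃ g₁ g₂, g₁ ∣ P - 1 ∧ g₂ ∣ P + 1 ∧ g = g₁ * g₂ :=
    exists_dvd_and_dvd_of_dvd_mul ⟨g * b * c - P * (d - a), by linear_combination hdetP⟩
  obtain ⟨x, y, k₁, k₂, k₃, k₄, k₅, β, hβ, hxy, hN⟩ :=
    exists_shift_MLambda (e := g₁) (b := g₂ * b) (u := u) (r := g₁ * g₂ * c) (s := P + g₁ * g₂ * (d - a))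
      hq hP (by linear_combination hdetP) (by linear_combination hu)
  obtain ⟨x', y', l₁, l₂, l₃, l₄, l₅, γ, hγ, hxy', hN'⟩ :=
    exists_shift_MLambdaT (p := -P) (e := g₂) (b := b) (u := -v) (r := -y) (s := -x)
      hq (neg_ne_zero.2 hP) (by linear_combination hxy) (by linear_combination -hv)
  obtain ⟨z₁, z₂, z₃, z₄, z₅, hD⟩ :=
    eq_mul_of_dvd_sub (p := P) (b := b) (r := -y') (s := -x') (E := C ε) (E' := C ε⁻¹)
      (by linear_combination hxy') (by rw [← C_mul, mul_inv_cancel₀ hε, C_1])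
      (by simpa using dvd_add hbP hb)
  refine ⟨_, mul_mem_FSet_three k₃ k₄ k₅, _, mul_mem_GSet_four l₃ l₄ (l₅ + k₁) k₂, _,
    mul_mem_GSet_nine z₁ z₂ z₃ z₄ z₅ l₁ l₂, β, hβ, γ, hγ, ?_⟩
  have h₁ : !![x, y; -(g₂ * b), P] = -!![-x, -y; g₂ * b, -P] := by simp
  have h₂ : !![-P, -b; y', x'] = -!![P, b; -y', -x'] := by simp
  rw [mul_assoc g₁, hN, h₁, hN', h₂, hD, ← m₂₁_mul_m₂₁]
  simp only [neg_mul, neg_neg, mul_assoc]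

/-- Corollary 3.6: with `A = 𝔽_q[T]` (`q` a power of an odd prime), let
`α = [[a, b], [c, d]] ∈ SL₂(A)` and suppose there are coprime positive integers `r, s`
and nonzero `ε₁, ε₂ ∈ 𝔽_q` with `b ∣ a^r − ε₁` and `c ∣ a^s − ε₂`.  Then
`α = χ₉ · γ · χ₄ · β · χ₃ · χ₉♡ · γ♡ · χ₄♡ · β♡ · χ₃♡` with `χ₃ ∈ F₃(A³)`,
`χ₄ ∈ G₄(A⁴)`, `χ₉ ∈ G₉(A⁹)`, `χ₃♡ ∈ G₃(A³)`, `χ₄♡ ∈ F₄(A⁴)`, `χ₉♡ ∈ F₉(A⁹)`,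
`γ♡, β ∈ M_Λ`, and `γ, β♡ ∈ M_Λᵀ`. -/
theorem corollary_coprime_decomposition
    (F : Type) [Field F] [Fintype F] (hq : Odd (Fintype.card F))
    (a b c d : Polynomial F)
    (hdet : (!![a, b; c, d] : Matrix (Fin 2) (Fin 2) (Polynomial F)).det = 1)
    (r s : ℕ) (hr : 1 ≤ r) (hs : 1 ≤ s) (hrs : Nat.Coprime r s)
    (ε₁ ε₂ : F) (hε₁ : ε₁ ≠ 0) (hε₂ : ε₂ ≠ 0)
    (hdvd₁ : b ∣ a ^ r - C ε₁) (hdvd₂ : c ∣ a ^ s - C ε₂) :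
    ∃ χ₃ ∈ FSet (Polynomial F) 3, ∃ χ₄ ∈ GSet (Polynomial F) 4,
      ∃ χ₉ ∈ GSet (Polynomial F) 9, ∃ χ₃h ∈ GSet (Polynomial F) 3,
        ∃ χ₄h ∈ FSet (Polynomial F) 4, ∃ χ₉h ∈ FSet (Polynomial F) 9,
          ∃ γh ∈ MLambda (Polynomial F), ∃ β ∈ MLambda (Polynomial F),
            ∃ γ ∈ MLambdaT (Polynomial F), ∃ βh ∈ MLambdaT (Polynomial F),
              (!![a, b; c, d] : Matrix (Fin 2) (Fin 2) (Polynomial F)) =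
                χ₉ * γ * χ₄ * β * χ₃ * χ₉h * γh * χ₄h * βh * χ₃h := by
  obtain ⟨u, v, huv⟩ : ∃ u v : ℕ, r * u = 1 + s * v := by
    rcases hs.eq_or_lt with rfl | hs
    · exact ⟨1, r - 1, by omega⟩
    · obtain ⟨u, -, hu⟩ := Nat.exists_mul_mod_eq_one_of_coprime hrs hs
      exact ⟨u, r * u / s, by rw [← hu, Nat.mod_add_div]⟩
  have hpow : ∀ {x : Polynomial F} {k : ℕ} {ε : F} (m : ℕ), x ∣ a ^ k - C ε →
      x ∣ a ^ (k * m) - C (ε ^ m) := fun m h => by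
    rw [pow_mul, C_pow]
    exact h.trans (sub_dvd_pow_sub_pow _ _ m)
  have hdet' : (!![a, c; b, d] : Matrix (Fin 2) (Fin 2) (Polynomial F)).det = 1 := by
    rw [Matrix.det_fin_two_of] at hdet ⊢
    linear_combination hdet
  obtain ⟨χ₃, hχ₃, χ₄, hχ₄, χ₉, hχ₉, β, hβ, γ, hγ, h⟩ :=
    pow_eq_mul_of_dvd hq hdet (r * u) (pow_ne_zero u hε₁) (hpow u hdvd₁)
  obtain ⟨χ₃', hχ₃', χ₄', hχ₄', χ₉', hχ₉', β', hβ', γ', hγ', h'⟩ :=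
    pow_eq_mul_of_dvd hq hdet' (s * v) (pow_ne_zero v hε₂) (hpow v hdvd₂)
  refine ⟨χ₃, hχ₃, χ₄, hχ₄, χ₉, hχ₉, _, conjJ_mem_GSet hχ₃', _, conjJ_mem_FSet hχ₄', _,
    conjJ_mem_FSet hχ₉', _, conjJ_mem_MLambda hγ', β, hβ, γ, hγ, _, conjJ_mem_MLambdaT hβ', ?_⟩
  have hc := congrArg (conjJ (Polynomial F)) h'
  simp only [map_mul, map_pow, conjJ_of] at hc
  have hinv : !![a, b; c, d] * !![d, -b; -c, a] = 1 := by
    rw [← Matrix.adjugate_fin_two_of, Matrix.mul_adjugate, hdet, one_smul]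
  calc (!![a, b; c, d] : Matrix (Fin 2) (Fin 2) (Polynomial F))
      = !![a, b; c, d] ^ (r * u) * !![d, -b; -c, a] ^ (s * v) := by
        have hcomm : Commute !![a, b; c, d] !![d, -b; -c, a] := by
          rw [Commute, SemiconjBy, hinv, mul_eq_one_comm.1 hinv]
        rw [huv, pow_add, pow_one, mul_assoc, ← hcomm.mul_pow, hinv, one_pow, mul_one]
    _ = _ := by
        rw [h, hc]
        simp only [mul_assoc]
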